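/- Let (V,E) be a connected simple graph equipped with a well-order <. Then the collection of well-ordered breadth-first traversals of (V,E) is nonempty and has a lexicographically least element with respect to <: there exists a well-ordered breadth-first traversal ≺ of (V,E) such that for every well-ordered breadth-first traversal R of (V,E) with R ≠ ≺, the order ≺ is lexicographically less than R. -/

import Mathlib

/-- `S` is an initial segment (downward-closed set) of the order `r`. -/
def IsInitialSeg {V : Type*} (r : V → V → Prop) (S : Set V) : Prop :=
  ∀ ⦃a b : V⦄, r a b → b ∈ S → a ∈ S

/-- `r` is a traversal of `G`: every nonempty initial segment of `r` induces a
connected subgraph of `G`. -/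
def IsTraversal {V : Type*} (G : SimpleGraph V) (r : V → V → Prop) : Prop :=
  ∀ S : Set V, IsInitialSeg r S → S.Nonempty → (G.induce S).Connected

/-- `m` is the least element of the order `r`. -/
def IsLeastElem {V : Type*} (r : V → V → Prop) (m : V) : Prop :=
  ∀ v : V, v ≠ m → r m v

/-- `prec` is the algorithmic traversal of `(G, lt)` starting at `v₀`:
`prec` is a well-order whose least element is `v₀`, and every other vertex `v`
is the `lt`-least element of the set of vertices outside `I_v = {u | prec u v}`
adjacent to some element of `I_v`. -/
def IsAlgTraversalFrom {V : Type*} (G : SimpleGraph V) (lt prec : V → V → Prop)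
    (v₀ : V) : Prop :=
  IsWellOrder V prec ∧ IsLeastElem prec v₀ ∧
  ∀ v : V, v ≠ v₀ →
    ((∃ u, prec u v ∧ G.Adj u v) ∧
     ∀ w : V, ¬ prec w v → (∃ u, prec u v ∧ G.Adj u w) → w ≠ v → lt v w)

/-- `prec` is the algorithmic traversal of `(G, lt)`: the algorithmic traversal
starting at the `lt`-least vertex. -/
def IsAlgTraversal {V : Type*} (G : SimpleGraph V) (lt prec : V → V → Prop) : Prop :=
  ∃ v₀ : V, IsLeastElem lt v₀ ∧ IsAlgTraversalFrom G lt prec v₀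


/-- `m` is the `r`-least neighbor of `v` in `G`. -/
def IsLeastNeighbor {V : Type*} (G : SimpleGraph V) (r : V → V → Prop)
    (v m : V) : Prop :=
  G.Adj v m ∧ ∀ w : V, G.Adj v w → ¬ r w m

/-- A traversal `prec` is breadth-first if its least neighbor function is weakly
monotone on vertices other than the `prec`-least one. -/
def IsBreadthFirst {V : Type*} (G : SimpleGraph V) (prec : V → V → Prop) : Prop :=
  ∀ u v pu pv : V, (∃ z, prec z u) → (∃ z, prec z v) →
    IsLeastNeighbor G prec u pu → IsLeastNeighbor G prec v pv →
    prec u v → (pu = pv ∨ prec pu pv)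

/-- `R` is lexicographically less than `R'` with respect to the order `lt`:
identifying a well-order with its enumeration, there is a position (ordinal) `γ`
at which the enumerations first differ, and there the value of `R` is `lt`-below
that of `R'`.  Concretely: there are `a b` with `lt a b` such that `a` and `b`
have the same set of strict predecessors `{u | R u a} = {u | R' u b}`, on which
`R` and `R'` agree (hence the enumerations of `R` and `R'` coincide up to some
ordinal `γ`, `a` is the `γ`-th element of `R`, and `b` is the `γ`-th element of
`R'`). -/
def LexLess {V : Type*} (lt R R' : V → V → Prop) : Prop :=
  ∃ a b : V, lt a b ∧ {u | R u a} = {u | R' u b} ∧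
    ∀ u v : V, R u a → R v a → (R u v ↔ R' u v)

/-- `IsWalkList G v₀ l v` says that `l` lists the vertices of a walk in `G` from `v₀` to `v`. -/
inductive IsWalkList {V : Type*} (G : SimpleGraph V) (v₀ : V) : List V → V → Prop
  | singleton : IsWalkList G v₀ [v₀] v₀
  | concat {l : List V} {p v : V} :
      IsWalkList G v₀ l p → G.Adj p v → IsWalkList G v₀ (l ++ [v]) v

namespace IsWalkList

variable {V : Type*} {G : SimpleGraph V} {v₀ u v : V} {l : List V}

theorem ne_nil (h : IsWalkList G v₀ l v) : l ≠ [] := by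
  cases h <;> simp

theorem getLast?_eq (h : IsWalkList G v₀ l v) : l.getLast? = some v := by
  cases h <;> simp

theorem target_unique (hu : IsWalkList G v₀ l u) (hv : IsWalkList G v₀ l v) : u = v :=
  Option.some.inj (hu.getLast?_eq.symm.trans hv.getLast?_eq)

theorem exists_of_connected (hG : G.Connected) (v₀ v : V) : ∃ l, IsWalkList G v₀ l v := by
  induction (SimpleGraph.reachable_iff_reflTransGen v₀ v).1 (hG v₀ v) with
  | refl => exact ⟨_, singleton⟩
  | tail _ hadj ih =>
    obtain ⟨l, hl⟩ := ih
    exact ⟨_, hl.concat hadj⟩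

end IsWalkList

namespace List

variable {α : Type*} {r : α → α → Prop} {s t : List α} {a b : α}

theorem Lex.concat (h : List.Lex r s t) (hlen : s.length = t.length) :
    List.Lex r (s ++ [a]) (t ++ [b]) := by
  induction h with
  | nil => simp at hlen
  | rel h => exact .rel h
  | cons _ ih => exact .cons (ih (by simpa using hlen))

theorem Shortlex.concat (h : Shortlex r s t) : Shortlex r (s ++ [a]) (t ++ [b]) := by
  rcases shortlex_def.1 h with h | ⟨hlen, h⟩
  · exact .of_length_lt (by simpa using h)
  · exact .of_lex (by simpa using hlen) (h.concat hlen)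

theorem Shortlex.rel_of_append_singleton [Std.Irrefl r] (h : Shortlex r (s ++ [a]) (s ++ [b])) :
    r a b := by
  induction s with
  | nil => simpa using h
  | cons _ _ ih => exact ih (shortlex_cons_iff.1 h)

theorem isWellOrder_shortlex [IsWellOrder α r] : IsWellOrder (List α) (Shortlex r) where
  wf := Shortlex.wf IsWellFounded.wf
  trichotomous := Std.Trichotomous.trichotomous

end List

section

variable {V : Type*} {G : SimpleGraph V}

/-- Every vertex `v` of a well-ordered connected graph can be assigned the shortlex least walk
`key v` to it from the least vertex; deleting its last vertex yields the key of the neighbor of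
`v` whose key is least. -/
theorem exists_shortlex_least_walks (hG : G.Connected) (lt : V → V → Prop) [IsWellOrder V lt] :
    ∃ (v₀ : V) (key : V → List V), IsLeastElem lt v₀ ∧ Function.Injective key ∧
      (∀ v, v ≠ v₀ → (key v₀).Shortlex lt (key v)) ∧
      ∀ v, v ≠ v₀ → ∃ p, G.Adj v p ∧ key v = key p ++ [v] ∧
        ∀ w, G.Adj v w → ¬ (key w).Shortlex lt (key p) := by
  have : IsWellOrder (List V) (List.Shortlex lt) := List.isWellOrder_shortlex
  have wf : WellFounded lt := IsWellFounded.wf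
  have wfs : WellFounded (List.Shortlex lt) := IsWellFounded.wf
  have : Nonempty V := hG.nonempty
  obtain ⟨v₀, -, hv₀⟩ := wf.has_min Set.univ Set.univ_nonempty
  have hleast (v : V) : ∃ l, IsWalkList G v₀ l v ∧
      ∀ l', IsWalkList G v₀ l' v → ¬ l'.Shortlex lt l :=
    wfs.has_min {l | IsWalkList G v₀ l v} (IsWalkList.exists_of_connected hG v₀ v)
  choose key hkey hmin using hleast
  refine ⟨v₀, key, fun v hv => ?_, fun u v h => ?_, fun v hv => ?_, fun v hv => ?_⟩
  · rcases trichotomous_of lt v₀ v with h | h | h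
    · exact h
    · exact absurd h.symm hv
    · exact absurd h (hv₀ v trivial)
  · exact (hkey u).target_unique (h ▸ hkey v)
  · refine .of_length_lt ?_
    have h₁ : (key v₀).length ≤ 1 := by
      by_contra! h
      exact hmin v₀ [v₀] .singleton (.of_length_lt (by simpa using h))
    have h₂ : 1 < (key v).length := by
      have h := hkey v
      generalize key v = l at h
      cases h with
      | singleton => exact absurd rfl hv
      | concat h _ => simpa using List.length_pos_iff.2 h.ne_nil
    lia
  · have hwalk := hkey v
    have hv_min := hmin v
    generalize key v = l at hwalk hv_min
    cases hwalk with
    | singleton => exact absurd rfl hv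
    | @concat l p _ hl hadj =>
      have hlp : l = key p := by
        rcases trichotomous_of (List.Shortlex lt) l (key p) with h | h | h
        · exact absurd h (hmin p l hl)
        · exact h
        · exact absurd h.concat (hv_min _ ((hkey p).concat hadj))
      subst hlp
      exact ⟨p, hadj.symm, rfl, fun w hw h => hv_min _ ((hkey w).concat hw.symm) h.concat⟩

/-- A relation with a least element in which every other vertex has a smaller neighbor is a
traversal. -/
theorem isTraversal_of_exists_adj {r : V → V → Prop} (wf : WellFounded r) {v₀ : V}
    (hv₀ : IsLeastElem r v₀) (h : ∀ v, v ≠ v₀ → ∃ p, G.Adj v p ∧ r p v) : IsTraversal G r := by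
  rintro S hS ⟨s, hs⟩
  have hmem : v₀ ∈ S := by
    by_cases hsv : s = v₀
    · exact hsv ▸ hs
    · exact hS (hv₀ s hsv) hs
  refine SimpleGraph.connected_iff_exists_forall_reachable _ |>.2 ⟨⟨v₀, hmem⟩, ?_⟩
  rintro ⟨v, hv⟩
  induction v using wf.induction with
  | _ v ih =>
    by_cases hvv : v = v₀
    · subst hvv
      exact .refl _
    · obtain ⟨p, hadj, hp⟩ := h v hvv
      refine (ih p hp (hS hp hv)).trans (SimpleGraph.Adj.reachable ?_)
      exact hadj.symm

theorem IsTraversal.exists_adj {r : V → V → Prop} [IsTrans V r] [Std.Irrefl r]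
    (h : IsTraversal G r) {v z : V} (hz : r z v) : ∃ u, G.Adj v u ∧ r u v := by
  have hconn := h {u | u = v ∨ r u v} (by
    rintro a b hab (rfl | hb)
    · exact .inr hab
    · exact .inr (trans_of r hab hb)) ⟨v, .inl rfl⟩
  obtain ⟨w⟩ := hconn ⟨v, .inl rfl⟩ ⟨z, .inr hz⟩
  cases w with
  | nil => exact absurd hz (irrefl_of r _)
  | @cons _ u _ hadj _ =>
    have hadj : G.Adj v u := hadj
    exact ⟨u, hadj, u.2.resolve_left hadj.ne'⟩

theorem IsTraversal.exists_isLeastNeighbor {r : V → V → Prop} [IsWellOrder V r]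
    (h : IsTraversal G r) {v z : V} (hz : r z v) : ∃ p, IsLeastNeighbor G r v p ∧ r p v := by
  obtain ⟨u, hadj, hu⟩ := h.exists_adj hz
  obtain ⟨p, hp, hmin⟩ := (IsWellFounded.wf (r := r)).has_min {w | G.Adj v w} ⟨u, hadj⟩
  refine ⟨p, ⟨hp, hmin⟩, ?_⟩
  rcases trichotomous_of r p u with hpu | rfl | hup
  · exact trans_of r hpu hu
  · exact hu
  · exact absurd hup (hmin u hadj)

/-- Two distinct well-orders first differ at some position, which is occupied by `a` in the
first and by `b` in the second. -/
theorem exists_first_difference {r s : V → V → Prop} [IsWellOrder V r] [IsWellOrder V s]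
    (hne : s ≠ r) : ∃ a b, r a b ∧ s b a ∧ (∀ u, r u a ↔ s u b) ∧
      ∀ u v, r v a → (r u v ↔ s u v) := by
  have hex : {a | ¬ ∀ u, r u a ↔ s u a}.Nonempty := by
    by_contra h
    refine hne ?_
    ext u v
    by_contra huv
    exact h ⟨v, fun hv => huv (hv u).symm⟩
  obtain ⟨a, ha, hamin⟩ := (IsWellFounded.wf (r := r)).has_min _ hex
  have hagree : ∀ u v, r v a → (r u v ↔ s u v) := fun u v hv =>
    not_not.1 (fun h => hamin v h hv) u
  obtain ⟨b, hb, hbmin⟩ := (IsWellFounded.wf (r := s)).has_min {v | ¬ r v a} ⟨a, irrefl_of r a⟩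
  have hpred : ∀ u, r u a ↔ s u b := fun u => by
    refine ⟨fun hu => ?_, fun hu => not_not.1 fun h => hbmin u h hu⟩
    rcases trichotomous_of s u b with h | rfl | h
    · exact h
    · exact absurd hu hb
    · exact absurd (trans_of r ((hagree b u hu).2 h) hu) hb
  have hab : a ≠ b := by
    rintro rfl
    exact ha hpred
  refine ⟨a, b, ?_, ?_, hpred, hagree⟩
  · exact ((trichotomous_of r a b).resolve_right (by
      rintro (h | h)
      exacts [hab h, hb h]))
  · rcases trichotomous_of s b a with h | h | h
    · exact h
    · exact absurd h.symm hab
    · exact absurd ((hpred a).2 h) (irrefl_of r a)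

end

/-- For a connected graph equipped with a well-order, the collection of well-ordered
breadth-first traversals is nonempty and has a lexicographically least element. -/
theorem exists_lex_least_bft
    {V : Type*} (G : SimpleGraph V) (hG : G.Connected)
    (lt : V → V → Prop) (hlt : IsWellOrder V lt) :
    ∃ prec : V → V → Prop, IsWellOrder V prec ∧
      IsTraversal G prec ∧ IsBreadthFirst G prec ∧
      ∀ R : V → V → Prop, IsWellOrder V R → IsTraversal G R → IsBreadthFirst G R →
        R ≠ prec → LexLess lt prec R := by
  have : IsWellOrder (List V) (List.Shortlex lt) := List.isWellOrder_shortlex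
  obtain ⟨v₀, key, hv₀, hinj, hroot, hparent⟩ := exists_shortlex_least_walks hG lt
  let prec : V → V → Prop := InvImage (List.Shortlex lt) key
  have hwo : IsWellOrder V prec :=
    (RelEmbedding.mk ⟨key, hinj⟩ Iff.rfl : prec ↪r List.Shortlex lt).isWellOrder
  have hne {v z : V} (hz : prec z v) : v ≠ v₀ := by
    rintro rfl
    by_cases h : z = v
    · exact irrefl_of prec v (h ▸ hz)
    · exact asymm_of prec hz (hroot z h)
  -- the `prec`-least neighbor is the last vertex but one of the key
  have hkey {v p : V} (hv : v ≠ v₀) (hp : IsLeastNeighbor G prec v p) :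
      key v = key p ++ [v] := by
    obtain ⟨q, hq, hvq, hqmin⟩ := hparent v hv
    rcases trichotomous_of prec p q with h | rfl | h
    · exact absurd h (hqmin p hp.1)
    · exact hvq
    · exact absurd h (hp.2 q hq)
  have htrav : IsTraversal G prec := by
    refine isTraversal_of_exists_adj IsWellFounded.wf hroot fun v hv => ?_
    obtain ⟨p, hp, hvp, -⟩ := hparent v hv
    exact ⟨p, hp, .of_length_lt (by simp [hvp])⟩
  have hbf : IsBreadthFirst G prec := by
    rintro u v pu pv ⟨_, hu⟩ ⟨_, hv⟩ hpu hpv huv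
    rcases trichotomous_of prec pu pv with h | h | h
    · exact .inr h
    · exact .inl h
    · have hvu : prec v u := by
        change List.Shortlex lt _ _
        rw [hkey (hne hu) hpu, hkey (hne hv) hpv]
        exact h.concat
      exact absurd hvu (asymm_of prec huv)
  refine ⟨prec, hwo, htrav, hbf, fun R hR hRtrav hRbf hRne => ?_⟩
  obtain ⟨a, b, hab, hba, hpred, hagree⟩ := exists_first_difference hRne
  refine ⟨a, b, ?_, Set.ext hpred, fun u v _ hv => hagree u v hv⟩
  by_cases ha : a = v₀
  · subst ha
    exact hv₀ b (hne hab)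
  have hza : prec v₀ a := hroot a ha
  obtain ⟨p, hp, hpa⟩ := htrav.exists_isLeastNeighbor hza
  obtain ⟨q, hq, hqb⟩ := hRtrav.exists_isLeastNeighbor ((hpred v₀).1 hza)
  have hqa := (hpred q).2 hqb
  have hpR : IsLeastNeighbor G R a p := ⟨hp.1, fun w hw h => hp.2 w hw ((hagree w p hpa).2 h)⟩
  have hqP : IsLeastNeighbor G prec b q := ⟨hq.1, fun w hw h => hq.2 w hw ((hagree w q hqa).1 h)⟩
  have hpq : p = q := by
    rcases hbf a b p q ⟨_, hza⟩ ⟨_, hab⟩ hp hqP hab with h | h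
    · exact h
    rcases hRbf b a q p ⟨_, hqb⟩ ⟨_, hba⟩ hq hpR hba with h' | h'
    · exact h'.symm
    · exact absurd ((hagree q p hpa).2 h') (asymm_of prec h)
  subst hpq
  have hlex : (key a).Shortlex lt (key b) := hab
  rw [hkey ha hp, hkey (hne hab) hqP] at hlex
  exact hlex.rel_of_append_singleton
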